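/- For every natural number n, define P(2n+1) = l·∑_{j=0}^{2n+1} l^j + l^2·( ∑_{k=0}^{n−1} (∑_{i=0}^{k} l^i)·(∑_{j=0}^{2n−k} l^j) )·(1+t) + l^2·(∑_{i=0}^{n} l^{2i})·t + l^2·( ∑_{i=1}^{n} ∑_{j=0}^{i−1} l^{i+j} )·(1+t) in R. Then P(2n+1) = l·∑_{i=0}^{2n+1} M(i)·L(2n+1−i). -/

import Mathlib

open Finset

section PowerSums

variable {R : Type*} [CommRing R] (l : R)

theorem geom_sum_add_eq (a b : ℕ) :
    ∑ i ∈ range (a + b), l ^ i = ∑ i ∈ range a, l ^ i + l ^ a * ∑ i ∈ range b, l ^ i := by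
  simp [sum_range_add, pow_add, mul_sum]

theorem sum_succ_mul_pow_succ (m : ℕ) :
    ∑ i ∈ range (m + 1), ((i : R) + 1) * l ^ i
      = l * ∑ i ∈ range m, ((i : R) + 1) * l ^ i + ∑ i ∈ range (m + 1), l ^ i := by
  induction m with
  | zero => simp
  | succ m ih =>
    simp only [sum_range_succ _ m, sum_range_succ _ (m + 1)] at ih ⊢
    push_cast
    linear_combination ih

theorem sum_geom_sum_mul_pow_succ (n : ℕ) :
    ∑ k ∈ range (n + 1), (∑ i ∈ range (k + 1), l ^ i) * l ^ (2 * (n + 1) - k + 1)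
      = l ^ 2 * ∑ k ∈ range n, (∑ i ∈ range (k + 1), l ^ i) * l ^ (2 * n - k + 1)
        + (∑ i ∈ range (n + 1), l ^ i) * l ^ (n + 3) := by
  rw [sum_range_succ, mul_sum]
  congr 1
  · refine sum_congr rfl fun k hk => ?_
    have hk := mem_range.1 hk
    rw [show 2 * (n + 1) - k + 1 = (2 * n - k + 1) + 2 by omega]
    ring
  · rw [show 2 * (n + 1) - n + 1 = n + 3 by omega]

theorem geom_sum_mul_geom_sum_add (n : ℕ) :
    (∑ i ∈ range (n + 1), l ^ i) * (∑ i ∈ range (n + 3), l ^ i)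
      + (1 + l) * ∑ k ∈ range n, (∑ i ∈ range (k + 1), l ^ i) * l ^ (2 * n - k + 1)
      + l ^ (n + 1) * ∑ i ∈ range (n + 1), l ^ i
      = ∑ i ∈ range (2 * n + 2), ((i : R) + 1) * l ^ i + ((n : R) + 1) * l ^ (2 * n + 2) := by
  induction n with
  | zero => simp [sum_range_succ]; ring
  | succ n ih =>
    have hgeom := geom_sum_mul l (n + 1)
    have hdouble := geom_sum_add_eq l (n + 1) (n + 1)
    rw [sum_geom_sum_mul_pow_succ, show 2 * (n + 1) + 2 = 2 * n + 2 + 1 + 1 by ring,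
      sum_succ_mul_pow_succ, sum_succ_mul_pow_succ]
    rw [show n + 1 + (n + 1) = 2 * n + 2 by ring] at hdouble
    simp only [sum_range_succ _ (2 * n + 2), sum_range_succ _ (2 * n + 2 + 1), hdouble]
    rw [show n + 1 + 3 = n + 1 + 1 + 1 + 1 by ring]
    rw [show n + 3 = n + 1 + 1 + 1 by ring] at ih ⊢
    simp only [sum_range_succ _ (n + 1), sum_range_succ _ (n + 1 + 1),
      sum_range_succ _ (n + 1 + 1 + 1)] at ih ⊢
    generalize ∑ i ∈ range (n + 1), l ^ i = g at *
    push_cast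
    linear_combination l ^ 2 * ih - (1 + l) * g * hgeom

theorem sum_geom_sum_mul_geom_sum_succ (n : ℕ) :
    ∑ k ∈ range (n + 1),
        (∑ i ∈ range (k + 1), l ^ i) * (∑ j ∈ range (2 * (n + 1) - k + 1), l ^ j)
      = ∑ k ∈ range n, (∑ i ∈ range (k + 1), l ^ i) * (∑ j ∈ range (2 * n - k + 1), l ^ j)
        + (1 + l) * ∑ k ∈ range n, (∑ i ∈ range (k + 1), l ^ i) * l ^ (2 * n - k + 1)
        + (∑ i ∈ range (n + 1), l ^ i) * (∑ i ∈ range (n + 3), l ^ i) := by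
  rw [sum_range_succ, mul_sum (range n), ← sum_add_distrib]
  congr 1
  · refine sum_congr rfl fun k hk => ?_
    have hk := mem_range.1 hk
    rw [show 2 * (n + 1) - k + 1 = (2 * n - k + 1) + 1 + 1 by omega,
      sum_range_succ _ (2 * n - k + 1 + 1), sum_range_succ _ (2 * n - k + 1)]
    ring
  · rw [show 2 * (n + 1) - n + 1 = n + 3 by omega]

end PowerSums

/-- Let `R` be a commutative ring and `l, t ∈ R` with `t^2 = 1`.
With `L, M : ℕ → R` as in the paper, for every natural number `n`, setting
`P(2n+1) = l·∑_{j=0}^{2n+1} l^j + l^2·(∑_{k=0}^{n−1} (∑_{i=0}^{k} l^i)(∑_{j=0}^{2n−k} l^j))·(1+t)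
  + l^2·(∑_{i=0}^{n} l^{2i})·t + l^2·(∑_{i=1}^{n} ∑_{j=0}^{i−1} l^{i+j})·(1+t)`,
we have `P(2n+1) = l · ∑_{i=0}^{2n+1} M i * L (2n+1−i)`. -/
theorem stmt3 {R : Type*} [CommRing R] (l t : R) (ht : t ^ 2 = 1)
    (L M : ℕ → R)
    (hL0 : L 0 = 1)
    (hLeven : ∀ n : ℕ, 1 ≤ n → L (2 * n) = (((n : R) + 1) + (n : R) * t) * l ^ (2 * n))
    (hLodd : ∀ n : ℕ, 1 ≤ n → L (2 * n - 1) = ((n : R) + (n : R) * t) * l ^ (2 * n - 1))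
    (hM0 : M 0 = 1)
    (hMeven : ∀ n : ℕ, 1 ≤ n →
      M (2 * n) = 1 + (n : R) * l + ((n - 1 : ℕ) : R) * l * t)
    (hModd : ∀ n : ℕ, 1 ≤ n →
      M (2 * n - 1) = 1 + ((n - 1 : ℕ) : R) * l + ((n - 1 : ℕ) : R) * l * t)
    (n : ℕ) :
    l * ∑ j ∈ range (2 * n + 2), l ^ j
      + l ^ 2 * (∑ k ∈ range n,
          (∑ i ∈ range (k + 1), l ^ i) * (∑ j ∈ range (2 * n - k + 1), l ^ j)) * (1 + t)
      + l ^ 2 * (∑ i ∈ range (n + 1), l ^ (2 * i)) * t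
      + l ^ 2 * (∑ i ∈ Icc 1 n, ∑ j ∈ range i, l ^ (i + j)) * (1 + t)
      = l * ∑ i ∈ range (2 * n + 2), M i * L (2 * n + 1 - i) := by
  have hsq : (1 + t) * t = 1 + t := by linear_combination ht
  have hL2 (k : ℕ) : L (2 * k) = (((k : R) + 1) + (k : R) * t) * l ^ (2 * k) := by
    rcases k with _ | k
    · simp [hL0]
    · exact hLeven _ k.succ_pos
  have hL1 (k : ℕ) : L (2 * k + 1) = ((k : R) + 1) * (1 + t) * l ^ (2 * k + 1) := by
    have h := hLodd (k + 1) k.succ_pos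
    rw [show 2 * (k + 1) - 1 = 2 * k + 1 by omega] at h
    rw [h]
    push_cast
    ring
  have hM2 (k : ℕ) : M (2 * k + 2) = 1 + ((k : R) + 1) * l + (k : R) * l * t := by
    have h := hMeven (k + 1) k.succ_pos
    rw [mul_add_one, Nat.add_sub_cancel] at h
    rw [h]
    push_cast
    ring
  have hM1 (k : ℕ) : M (2 * k + 1) = 1 + (k : R) * l + (k : R) * l * t := by
    have h := hModd (k + 1) k.succ_pos
    rwa [show 2 * (k + 1) - 1 = 2 * k + 1 by omega, Nat.add_sub_cancel] at h
  have hMstep (k : ℕ) : M (k + 3) = M (k + 1) + (1 + t) * l := by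
    obtain ⟨j, rfl | rfl⟩ := k.even_or_odd'
    · rw [show 2 * j + 3 = 2 * (j + 1) + 1 by ring, hM1, hM1]
      push_cast
      ring
    · rw [show 2 * j + 1 + 3 = 2 * (j + 1) + 2 by ring, hM2, hM2]
      push_cast
      ring
  have hLmul (k : ℕ) : (1 + t) * L k = (1 + t) * (((k : R) + 1) * l ^ k) := by
    obtain ⟨j, rfl | rfl⟩ := k.even_or_odd'
    · rw [hL2]
      push_cast
      linear_combination (j : R) * l ^ (2 * j) * hsq
    · rw [hL1]
      push_cast
      linear_combination ((j : R) + 1) * l ^ (2 * j + 1) * hsq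
  have hconv (n : ℕ) : ∑ i ∈ range (2 * (n + 1) + 2), M i * L (2 * (n + 1) + 1 - i)
      = ∑ i ∈ range (2 * n + 2), M i * L (2 * n + 1 - i)
        + l * ((1 + t) * ∑ m ∈ range (2 * n + 1), ((m : R) + 1) * l ^ m)
        + l * L (2 * n + 1) + L (2 * n + 2) + L (2 * n + 3) := by
    have hM₁ : M 1 = 1 := by simpa using hM1 0
    have hM₂ : M 2 = 1 + l := by simpa using hM2 0
    have htail : ∑ i ∈ range (2 * n + 1), M (i + 1 + 2) * L (2 * (n + 1) + 1 - (i + 1 + 2))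
        = ∑ i ∈ range (2 * n + 1), M (i + 1) * L (2 * n + 1 - (i + 1))
          + l * ((1 + t) * ∑ i ∈ range (2 * n + 1), L i) := by
      rw [← sum_range_reflect L, mul_sum, mul_sum, ← sum_add_distrib]
      refine sum_congr rfl fun i hi => ?_
      rw [show 2 * (n + 1) + 1 - (i + 1 + 2) = 2 * n + 1 - 1 - i by omega,
        show 2 * n + 1 - (i + 1) = 2 * n + 1 - 1 - i by omega, hMstep]
      ring
    have hweight : (1 + t) * ∑ m ∈ range (2 * n + 1), L m
        = (1 + t) * ∑ m ∈ range (2 * n + 1), ((m : R) + 1) * l ^ m := by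
      simp only [mul_sum, hLmul]
    rw [show 2 * (n + 1) + 2 = 2 * n + 1 + 1 + 1 + 1 by ring, sum_range_succ', sum_range_succ',
      sum_range_succ', show 2 * n + 2 = 2 * n + 1 + 1 by ring, sum_range_succ' _ (2 * n + 1),
      ← hweight]
    simp only [add_assoc, Nat.reduceAdd, zero_add] at htail ⊢
    rw [htail, hM0, hM₁, hM₂, show 2 * (n + 1) + 1 - 2 = 2 * n + 1 by omega,
      show 2 * (n + 1) + 1 - 1 = 2 * n + 2 by omega,
      show 2 * (n + 1) + 1 - 0 = 2 * n + 3 by omega, Nat.sub_zero]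
    ring
  induction n with
  | zero =>
    have h₁ := hL1 0
    have h₂ := hM1 0
    simp only [mul_zero, zero_add] at h₁ h₂
    simp [sum_range_succ, hL0, hM0, h₁, h₂]
    ring
  | succ n ih =>
    have hid := geom_sum_mul_geom_sum_add l n
    have hlast : ∑ j ∈ range (n + 1), l ^ (n + 1 + j)
        = l ^ (n + 1) * ∑ j ∈ range (n + 1), l ^ j := by
      simp only [pow_add, mul_sum]
    have h₂ := hL2 (n + 1)
    have h₃ := hL1 (n + 1)
    rw [show 2 * (n + 1) = 2 * n + 2 by ring] at h₂ h₃
    rw [hconv, sum_geom_sum_mul_geom_sum_succ, sum_Icc_succ_top (by omega), hlast,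
      sum_range_succ _ (n + 1), show 2 * (n + 1) + 2 = 2 * n + 2 + 1 + 1 by ring,
      sum_range_succ _ (2 * n + 2 + 1), sum_range_succ _ (2 * n + 2), hL1, h₂, h₃]
    rw [sum_range_succ _ (2 * n + 1)] at hid
    push_cast at hid ⊢
    linear_combination ih + l ^ 2 * (1 + t) * hid
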